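/- arXiv:1706.03987 — 2 statements merged into one kernel-verified Lean document; each statement's English description precedes it below -/
import Mathlib

section
/- Let i ≥ 1 and n ≥ 2i. Any eigenfunction of the Johnson graph J(n,i) with the minimum eigenvalue -i (i.e., λ_i(n,i)) has support of size at least 2^i. -/
open Finset

/-- A nonzero function on subsets whose sums over all up-sets of sets of size `< t` vanish
has support of size at least `2 ^ t`. -/
lemma null_design_support {α : Type*} [Fintype α] [DecidableEq α] (t : ℕ) :
    ∀ (F : Finset α → ℝ),
      (∀ T : Finset α, T.card < t → ∑ x, (if T ⊆ x then F x else 0) = 0) →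
      (∃ x, F x ≠ 0) → 2 ^ t ≤ (univ.filter (fun x => F x ≠ 0)).card := by
  induction t with
  | zero =>
    rintro F - ⟨x, hx⟩
    have : 0 < (univ.filter (fun x => F x ≠ 0)).card :=
      card_pos.mpr ⟨x, by simpa using hx⟩
    simpa using this
  | succ t ih =>
    rintro F hF ⟨x, hx⟩
    have h0 : ∑ y, F y = 0 := by simpa using hF ∅ (by simp)
    obtain ⟨y, hy, hxy⟩ : ∃ y, F y ≠ 0 ∧ y ≠ x := by
      by_contra! hcon
      rw [Finset.sum_eq_single x] at h0
      · exact hx h0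
      · intro b _ hb
        by_contra hb'
        exact hb (hcon b hb')
      · simp
    obtain ⟨a, ⟨u, hu, hau⟩, ⟨v, hv, hav⟩⟩ :
        ∃ a, (∃ u, F u ≠ 0 ∧ a ∈ u) ∧ (∃ v, F v ≠ 0 ∧ a ∉ v) := by
      by_contra! hcon
      apply hxy
      ext a
      constructor
      · intro h
        exact hcon a ⟨y, hy, h⟩ x hx
      · intro h
        exact hcon a ⟨x, hx, h⟩ y hy
    have key : ∀ T : Finset α, T.card < t →
        ∑ x, (if T ⊆ x then (if a ∈ x then F x else 0) else 0) = 0 := by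
      intro T hT
      refine Eq.trans ?_ (hF (insert a T) (by have := card_insert_le a T; omega))
      apply sum_congr rfl
      intro x _
      by_cases h1 : a ∈ x <;> by_cases h2 : T ⊆ x <;> simp [insert_subset_iff, h1, h2]
    have h1 := ih (fun x => if a ∈ x then F x else 0) key ⟨u, by simp [hau, hu]⟩
    have h2 := ih (fun x => if a ∈ x then 0 else F x) (by
      intro T hT
      have e1 := key T hT
      have e2 := hF T (by omega)
      suffices h : ∑ x, (if T ⊆ x then (if a ∈ x then 0 else F x) else 0)
          + ∑ x, (if T ⊆ x then (if a ∈ x then F x else 0) else 0)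
          = ∑ x, (if T ⊆ x then F x else 0) by linarith
      rw [← sum_add_distrib]
      apply sum_congr rfl
      intro x _
      by_cases h1 : a ∈ x <;> by_cases h2 : T ⊆ x <;> simp [h1, h2]) ⟨v, by simp [hav, hv]⟩
    have h3 := card_filter_add_card_filter_not (s := univ.filter (fun x => F x ≠ 0))
      (fun x => a ∈ x)
    have e1 : univ.filter (fun x => (if a ∈ x then F x else 0) ≠ 0)
        = (univ.filter (fun x => F x ≠ 0)).filter (fun x => a ∈ x) := by
      ext x; by_cases h : a ∈ x <;> simp [h]
    have e2 : univ.filter (fun x => (if a ∈ x then 0 else F x) ≠ 0)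
        = (univ.filter (fun x => F x ≠ 0)).filter (fun x => ¬ a ∈ x) := by
      ext x; by_cases h : a ∈ x <;> simp [h]
    rw [e1] at h1
    rw [e2] at h2
    rw [pow_succ]
    omega

/-- Vanishing of up-set sums descends from sets of size `k` to smaller sets. -/
lemma upsum_descend {α : Type*} [Fintype α] [DecidableEq α] (k : ℕ) (F : Finset α → ℝ)
    (hsupp : ∀ x, x.card ≠ k + 1 → F x = 0)
    (htop : ∀ T : Finset α, T.card = k → ∑ x, (if T ⊆ x then F x else 0) = 0) (d : ℕ) :
    ∀ T : Finset α, T.card + d = k → ∑ x, (if T ⊆ x then F x else 0) = 0 := by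
  induction d with
  | zero => intro T hT; exact htop T hT
  | succ d ih =>
    intro T hT
    have h1 : ∑ a ∈ Tᶜ, ∑ x, (if insert a T ⊆ x then F x else 0) = 0 := by
      apply sum_eq_zero
      intro a ha
      apply ih
      rw [card_insert_of_notMem (by simpa using ha)]
      omega
    rw [sum_comm] at h1
    have h2 : ∀ x, ∑ a ∈ Tᶜ, (if insert a T ⊆ x then F x else 0)
        = ((d : ℝ) + 2) * (if T ⊆ x then F x else 0) := by
      intro x
      by_cases hx : x.card = k + 1
      · by_cases hT' : T ⊆ x
        · have : ∀ a, (insert a T ⊆ x) ↔ a ∈ x := fun a => by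
            rw [insert_subset_iff]; tauto
          simp only [this, hT', if_true]
          rw [← sum_filter, sum_const]
          have e : Tᶜ.filter (fun a => a ∈ x) = x \ T := by
            ext a; simp [and_comm]
          have c : (x \ T).card = d + 2 := by
            rw [card_sdiff_of_subset hT']; omega
          rw [e, c]
          simp
        · have : ∀ a, ¬ (insert a T ⊆ x) := fun a h =>
            hT' ((subset_insert a T).trans h)
          simp [this, hT']
      · simp [hsupp x hx]
    simp only [h2] at h1
    rw [← mul_sum] at h1
    rcases mul_eq_zero.mp h1 with h | h
    · exact absurd h (by positivity)
    · exact h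

/-- Any eigenfunction of `J(n,i)` with the minimum eigenvalue `-i` has support of
size at least `2^i` (for `i ≥ 1`, `n ≥ 2i`). -/
theorem min_eigen_support_bound (n i : ℕ) (hi : 1 ≤ i) (hn : 2 * i ≤ n)
    (f : Finset (Fin n) → ℝ)
    (hne : ∃ x : Finset (Fin n), x.card = i ∧ f x ≠ 0)
    (hf : ∀ x : Finset (Fin n), x.card = i →
      ∑ y ∈ univ.filter (fun y : Finset (Fin n) => y.card = i ∧ (x ∩ y).card + 1 = i), f y
        = -(i : ℝ) * f x) :
    2 ^ i ≤ (univ.filter (fun x : Finset (Fin n) => x.card = i ∧ f x ≠ 0)).card := by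
  obtain ⟨k, rfl⟩ : ∃ k, i = k + 1 := ⟨i - 1, by omega⟩
  set F : Finset (Fin n) → ℝ := fun x => if x.card = k + 1 then f x else 0 with hFdef
  have hsupp : ∀ x, x.card ≠ k + 1 → F x = 0 := fun x hx => by simp [hFdef, hx]
  -- the Gram matrix of the inclusion matrix
  have hgram : ∀ x y : Finset (Fin n),
      ∑ z ∈ powersetCard k (univ : Finset (Fin n)),
        (if z ⊆ x then F x else 0) * (if z ⊆ y then F y else 0)
      = F x * (((x ∩ y).card.choose k : ℝ) * F y) := by
    intro x y
    have e : ∀ z : Finset (Fin n), (if z ⊆ x then F x else 0) * (if z ⊆ y then F y else 0)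
        = if z ⊆ x ∩ y then F x * F y else 0 := by
      intro z
      by_cases h1 : z ⊆ x <;> by_cases h2 : z ⊆ y <;> simp [subset_inter_iff, h1, h2]
    simp only [e]
    rw [← sum_filter, sum_const]
    have e' : (powersetCard k (univ : Finset (Fin n))).filter (fun z => z ⊆ x ∩ y)
        = powersetCard k (x ∩ y) := by
      ext z; simp [mem_powersetCard, and_comm]
    rw [e', card_powersetCard, nsmul_eq_mul]
    ring
  have hrow : ∀ x : Finset (Fin n), x.card = k + 1 →
      ∑ y, ((x ∩ y).card.choose k : ℝ) * F y = 0 := by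
    intro x hx
    have e : ∀ y, ((x ∩ y).card.choose k : ℝ) * F y
        = (if x = y then ((k : ℝ) + 1) * f y else 0)
          + (if y.card = k + 1 ∧ (x ∩ y).card + 1 = k + 1 then f y else 0) := by
      intro y
      by_cases hy : y.card = k + 1
      · by_cases hxy : x = y
        · subst hxy
          simp [hFdef, hx]
        · have hlt : (x ∩ y).card < k + 1 := by
            by_contra hge
            have a1 : x ∩ y = x := eq_of_subset_of_card_le inter_subset_left (by omega)
            have a2 : x ∩ y = y := eq_of_subset_of_card_le inter_subset_right (by omega)
            exact hxy (a1.symm.trans a2)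
          by_cases hc : (x ∩ y).card = k
          · simp [hFdef, hy, hxy, hc]
          · rw [Nat.choose_eq_zero_of_lt (by omega)]
            simp [hxy, hc]
      · have hxy : x ≠ y := fun h => hy (h ▸ hx)
        simp [hFdef, hy, hxy]
    simp only [e]
    rw [sum_add_distrib, ← sum_filter (fun y : Finset (Fin n) => y.card = k + 1 ∧ (x ∩ y).card + 1 = k + 1), hf x hx]
    simp
    ring
  have hsq : ∑ z ∈ powersetCard k (univ : Finset (Fin n)),
      (∑ x, (if z ⊆ x then F x else 0)) ^ 2 = 0 := by
    simp only [pow_two, sum_mul_sum]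
    rw [sum_comm]
    apply sum_eq_zero
    intro x _
    rw [sum_comm]
    simp only [hgram]
    rw [← mul_sum]
    by_cases hx : x.card = k + 1
    · rw [hrow x hx, mul_zero]
    · rw [hsupp x hx, zero_mul]
  have htop : ∀ T : Finset (Fin n), T.card = k → ∑ x, (if T ⊆ x then F x else 0) = 0 := by
    intro T hT
    have := (sum_eq_zero_iff_of_nonneg (fun z _ => sq_nonneg _)).mp hsq T
      (by simp [mem_powersetCard, hT])
    exact pow_eq_zero_iff (two_ne_zero) |>.mp this
  have main := null_design_support (k + 1) F (fun T hT =>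
    upsum_descend k F hsupp htop (k - T.card) T (by omega)) (by
      obtain ⟨x, hx, hfx⟩ := hne
      exact ⟨x, by simpa [hFdef, hx] using hfx⟩)
  have e : univ.filter (fun x : Finset (Fin n) => x.card = k + 1 ∧ f x ≠ 0)
      = univ.filter (fun x => F x ≠ 0) := by
    ext x; by_cases h : x.card = k + 1 <;> simp [hFdef, h]
  rw [e]
  exact main
end

section
/- For all positive integers i ≤ w there exists n_0(i,w) such that for all n ≥ n_0(i,w), every nonzero eigenfunction f of the Johnson graph J(n,w) with eigenvalue (w-i)(n-w-i) - i satisfies |supp(f)| ≥ 2^i · C(n-2i, w-i). -/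
open Finset

section JohnsonAux
variable {α : Type*} [DecidableEq α]

/-- Eigenfunction equation on the Johnson graph over the ground set `V`. -/
def Eig (V : Finset α) (w : ℕ) (lam : ℝ) (f : Finset α → ℝ) : Prop :=
  ∀ x ⊆ V, x.card = w → ∑ a ∈ x, ∑ b ∈ V \ x, f (insert b (x.erase a)) = lam * f x

/-- Support. -/
noncomputable def jsupp (V : Finset α) (w : ℕ) (f : Finset α → ℝ) : Finset (Finset α) :=
  (powersetCard w V).filter (fun x => f x ≠ 0)

theorem mem_jsupp {V : Finset α} {w : ℕ} {f : Finset α → ℝ} {x : Finset α} :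
    x ∈ jsupp V w f ↔ (x ⊆ V ∧ x.card = w) ∧ f x ≠ 0 := by
  simp [jsupp, mem_powersetCard]

theorem eig_half {V : Finset α} {w : ℕ} {lam : ℝ} {f : Finset α → ℝ} {j k : α}
    (hk : k ∈ V) (hj : j ∈ V) (hjk : j ≠ k) (h : Eig V (w + 1) lam f)
    (y : Finset α) (hy : y ⊆ (V.erase j).erase k) (hc : y.card = w) :
    f (insert k y) + ∑ b ∈ ((V.erase j).erase k) \ y, f (insert b y)
     + (∑ a ∈ y, f (insert j (insert k (y.erase a)))
     + ∑ a ∈ y, ∑ b ∈ ((V.erase j).erase k) \ y, f (insert j (insert b (y.erase a))))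
     = lam * f (insert j y) := by
  have hjy : j ∉ y := fun h => by simpa using hy h
  have hky : k ∉ y := fun h => by simpa using hy h
  have hV : V \ insert j y = insert k (((V.erase j).erase k) \ y) := by
    ext b
    simp only [mem_sdiff, mem_insert, mem_erase]
    by_cases hb : b = k
    · subst hb; simp [hk, hky, Ne.symm hjk]
    · simp [hb]; tauto
  have hkn : k ∉ ((V.erase j).erase k) \ y := by simp
  have hyV : y ⊆ V := hy.trans ((erase_subset _ _).trans (erase_subset _ _))
  have := h (insert j y) (insert_subset hj hyV) (by rw [card_insert_of_notMem hjy, hc])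
  rw [← this, sum_insert hjy, hV, erase_insert hjy, sum_insert hkn]
  congr 1
  rw [← sum_add_distrib]
  apply sum_congr rfl
  intro a ha
  have haj : a ≠ j := fun e => hjy (e ▸ ha)
  rw [sum_insert hkn, erase_insert_of_ne haj.symm, insert_comm j k]
  congr 1
  apply sum_congr rfl
  intro b hb
  rw [insert_comm j b]

theorem eig_diff {V : Finset α} {w : ℕ} {lam : ℝ} {f : Finset α → ℝ} {j k : α}
    (hk : k ∈ V) (hj : j ∈ V) (hjk : j ≠ k) (h : Eig V (w + 1) lam f) :
    Eig ((V.erase j).erase k) w (lam + 1) (fun y => f (insert j y) - f (insert k y)) := by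
  intro y hy hc
  have h1 := eig_half hk hj hjk h y hy hc
  have h2 := eig_half hj hk hjk.symm h y (by rwa [erase_right_comm]) hc
  rw [erase_right_comm] at h2
  have h3 : ∑ a ∈ y, f (insert j (insert k (y.erase a)))
      = ∑ a ∈ y, f (insert k (insert j (y.erase a))) :=
    sum_congr rfl fun a _ => by rw [insert_comm j k]
  simp only [sum_sub_distrib]
  linarith

/-- Connectivity by exchange steps. -/
theorem exch_conn (V : Finset α) (w : ℕ) (Q : Finset α → Prop) (x' : Finset α)
    (hx' : x' ⊆ V) (hx'c : x'.card = w)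
    (step : ∀ z ⊆ V, z.card = w → Q z → ∀ a ∈ z, a ∉ x' → ∀ b ∈ x', b ∉ z →
      Q (insert b (z.erase a))) :
    ∀ d : ℕ, ∀ x ⊆ V, x.card = w → Q x → (x \ x').card = d → Q x' := by
  intro d
  induction d with
  | zero =>
    intro x hx hxc hQ hd
    have : x ⊆ x' := by rwa [card_eq_zero, sdiff_eq_empty_iff_subset] at hd
    rwa [← eq_of_subset_of_card_le this (by omega)]
  | succ d ih =>
    intro x hx hxc hQ hd
    have hd' : (x' \ x).card = d + 1 := by
      rw [← hd]; exact card_sdiff_comm (by omega)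
    obtain ⟨a, ha⟩ := card_pos.mp (show 0 < (x \ x').card by omega)
    obtain ⟨b, hb⟩ := card_pos.mp (show 0 < (x' \ x).card by omega)
    rw [mem_sdiff] at ha hb
    have hbe : b ∉ x.erase a := fun h => hb.2 (mem_of_mem_erase h)
    refine ih (insert b (x.erase a)) ?_ ?_ (step x hx hxc hQ a ha.1 ha.2 b hb.1 hb.2) ?_
    · exact insert_subset (hx' hb.1) ((erase_subset _ _).trans hx)
    · rw [card_insert_of_notMem hbe, card_erase_of_mem ha.1]
      have := card_pos.mpr ⟨a, ha.1⟩
      omega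
    · have : insert b (x.erase a) \ x' = (x \ x').erase a := by
        ext c; simp only [mem_sdiff, mem_insert, mem_erase]
        constructor
        · rintro ⟨rfl | h, h2⟩
          · exact absurd hb.1 h2
          · tauto
        · tauto
      rw [this, card_erase_of_mem (mem_sdiff.mpr ha), hd]; rfl

theorem base_case (V : Finset α) (w : ℕ) (hw : w ≤ V.card) (f : Finset α → ℝ)
    (hE : Eig V w ((w : ℝ) * ((V.card : ℝ) - w)) f)
    (x₀ : Finset α) (hx₀ : x₀ ⊆ V) (hc₀ : x₀.card = w) (hf : f x₀ ≠ 0) :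
    (V.card).choose w ≤ (jsupp V w f).card := by
  obtain ⟨x, hx, hmax⟩ := exists_max_image (powersetCard w V) f
    ⟨x₀, mem_powersetCard.mpr ⟨hx₀, hc₀⟩⟩
  rw [mem_powersetCard] at hx
  have hstep : ∀ z ⊆ V, z.card = w → f z = f x → ∀ a ∈ z, ∀ b ∈ V, b ∉ z →
      f (insert b (z.erase a)) = f x := by
    intro z hz hzc hzf
    have h1 := hE z hz hzc
    have hm : ∀ a ∈ z, ∀ b ∈ V \ z, f (insert b (z.erase a)) ≤ f x := by
      intro a ha b hb
      rw [mem_sdiff] at hb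
      apply hmax
      rw [mem_powersetCard]
      refine ⟨insert_subset hb.1 ((erase_subset _ _).trans hz), ?_⟩
      rw [card_insert_of_notMem (fun h => hb.2 (mem_of_mem_erase h)), card_erase_of_mem ha]
      have := card_pos.mpr ⟨a, ha⟩
      omega
    have h2 : ∑ a ∈ z, ∑ b ∈ V \ z, (f x - f (insert b (z.erase a))) = 0 := by
      simp only [sum_sub_distrib, sum_const, nsmul_eq_mul]
      rw [h1, hzf, card_sdiff_of_subset hz, hzc, Nat.cast_sub hw]
      ring
    intro a ha b hb hbz
    rw [sum_eq_zero_iff_of_nonneg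
      (fun a ha => sum_nonneg fun b hb => sub_nonneg.mpr (hm a ha b hb))] at h2
    have h3 := h2 a ha
    rw [sum_eq_zero_iff_of_nonneg (fun b hb => sub_nonneg.mpr (hm a ha b hb))] at h3
    have := h3 b (mem_sdiff.mpr ⟨hb, hbz⟩)
    linarith
  have hall : ∀ x' ⊆ V, x'.card = w → f x' = f x := by
    intro x' hx' hc'
    exact exch_conn V w (fun z => f z = f x) x' hx' hc'
      (fun z hz hzc hQ a ha _ b hb hbz => hstep z hz hzc hQ a ha b (hx' hb) hbz)
      _ x hx.1 hx.2 rfl rfl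
  have : jsupp V w f = powersetCard w V := by
    rw [jsupp, filter_eq_self]
    intro y hy
    rw [mem_powersetCard] at hy
    rw [hall y hy.1 hy.2, ← hall x₀ hx₀ hc₀]; exact hf
  rw [this, card_powersetCard]

/-- Interchangeable elements. -/
def Itc (V : Finset α) (w : ℕ) (f : Finset α → ℝ) (j k : α) : Prop :=
  ∀ y ⊆ V, y.card = w → j ∉ y → k ∉ y → f (insert j y) = f (insert k y)

theorem Itc.symm {V : Finset α} {w : ℕ} {f : Finset α → ℝ} {j k : α}
    (h : Itc V w f j k) : Itc V w f k j := fun y hy hc hj hk => (h y hy hc hk hj).symm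

theorem Itc.trans {V : Finset α} {w : ℕ} {f : Finset α → ℝ} {j k l : α}
    (hjV : j ∈ V) (hlV : l ∈ V)
    (h : Itc V w f j k) (h' : Itc V w f k l) : Itc V w f j l := by
  intro y hy hc hj hl
  by_cases hjl : j = l
  · rw [hjl]
  by_cases hk : k ∈ y
  · have hkj : k ≠ j := fun e => hj (e ▸ hk)
    have hkl : k ≠ l := fun e => hl (e ▸ hk)
    have hz : (y.erase k) ⊆ V := (erase_subset _ _).trans hy
    have hpos := card_pos.mpr ⟨k, hk⟩
    have hjz : j ∉ y.erase k := fun h => hj (mem_of_mem_erase h)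
    have hlz : l ∉ y.erase k := fun h => hl (mem_of_mem_erase h)
    have e1 := h' (insert j (y.erase k)) (insert_subset hjV hz)
      (by rw [card_insert_of_notMem hjz, card_erase_of_mem hk]; omega)
      (by simp [hkj]) (by simp [Ne.symm hjl, hl])
    have e2 := h (insert l (y.erase k)) (insert_subset hlV hz)
      (by rw [card_insert_of_notMem hlz, card_erase_of_mem hk]; omega)
      (by simp [hjl, hj]) (by simp [hkl])
    rw [insert_comm k j, insert_erase hk] at e1
    rw [insert_comm k l, insert_erase hk] at e2
    rw [e1, ← e2, insert_comm l j]
  · rw [h y hy hc hj hk, h' y hy hc hk hl]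

/-- Frankl-Pach type lemma. -/
theorem frankl_pach (S : Finset α) (t : ℕ) : ∀ F : Finset α → ℝ,
    (∀ v : Finset α, v.card < t → ∑ y ∈ S.powerset.filter (fun y => v ⊆ y), F y = 0) →
    (∃ y ⊆ S, F y ≠ 0) → 2 ^ t ≤ (S.powerset.filter (fun y => F y ≠ 0)).card := by
  induction t with
  | zero =>
    rintro F - ⟨y, hy, hF⟩
    exact card_pos.mpr ⟨y, by simp [hy, hF]⟩
  | succ t ih =>
    rintro F hF ⟨y, hy, hFy⟩
    have h0 := hF ∅ (by simp)
    simp only [empty_subset, filter_true] at h0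
    obtain ⟨y', hy', hFy', hne⟩ : ∃ y' ⊆ S, F y' ≠ 0 ∧ y' ≠ y := by
      by_contra! hcon
      rw [sum_eq_single y] at h0
      · exact hFy h0
      · intro b hb hne
        by_contra hb'
        exact hne (hcon b (mem_powerset.mp hb) hb')
      · intro h; exact absurd (mem_powerset.mpr hy) h
    have key : ∀ a : α, (∃ y ⊆ S, F y ≠ 0 ∧ a ∈ y) → (∃ y ⊆ S, F y ≠ 0 ∧ a ∉ y) →
        2 ^ (t + 1) ≤ (S.powerset.filter (fun y => F y ≠ 0)).card := by
      rintro a ⟨y1, h1S, h1F, h1a⟩ ⟨y2, h2S, h2F, h2a⟩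
      have n1 : ∀ v : Finset α, v.card < t → ∑ y ∈ S.powerset.filter (fun y => v ⊆ y),
          (if a ∈ y then F y else 0) = 0 := by
        intro v hv
        refine Eq.trans ?_ (hF (insert a v) (lt_of_le_of_lt (card_insert_le _ _) (by omega)))
        rw [← sum_filter, filter_filter]
        apply sum_congr _ (fun _ _ => rfl)
        ext z; simp [insert_subset_iff]; tauto
      have n2 : ∀ v : Finset α, v.card < t → ∑ y ∈ S.powerset.filter (fun y => v ⊆ y),
          (if a ∈ y then 0 else F y) = 0 := by
        intro v hv
        have e1 := n1 v hv
        have e2 := hF v (by omega)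
        have : ∀ y, (if a ∈ y then 0 else F y) = F y - (if a ∈ y then F y else 0) := by
          intro y; split_ifs <;> simp
        simp only [this, sum_sub_distrib, e1, e2, sub_zero]
      have c1 := ih _ n1 ⟨y1, h1S, by simp [h1a, h1F]⟩
      have c2 := ih _ n2 ⟨y2, h2S, by simp [h2a, h2F]⟩
      have hd : Disjoint (S.powerset.filter (fun y => (if a ∈ y then F y else 0) ≠ 0))
          (S.powerset.filter (fun y => (if a ∈ y then 0 else F y) ≠ 0)) := by
        rw [disjoint_filter]
        intro z _ h1 h2
        by_cases ha : a ∈ z <;> simp [ha] at h1 h2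
      calc 2 ^ (t + 1) = 2 ^ t + 2 ^ t := by ring
        _ ≤ _ := add_le_add c1 c2
        _ = _ := (card_union_of_disjoint hd).symm
        _ ≤ _ := by
          apply card_le_card
          intro z
          simp only [mem_union, mem_filter]
          by_cases ha : a ∈ z <;> simp [ha]
    by_cases hsub : y ⊆ y'
    · have : ¬ y' ⊆ y := fun h => hne (h.antisymm hsub)
      obtain ⟨a, ha, ha'⟩ := not_subset.mp this
      exact key a ⟨y', hy', hFy', ha⟩ ⟨y, hy, hFy, ha'⟩
    · obtain ⟨a, ha, ha'⟩ := not_subset.mp hsub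
      exact key a ⟨y, hy, hFy, ha⟩ ⟨y', hy', hFy', ha'⟩

/-- Degree version: every point covered by the support is covered many times. -/
theorem frankl_pach_deg (S : Finset α) (t : ℕ) (F : Finset α → ℝ)
    (hF : ∀ v : Finset α, v.card < t + 1 →
      ∑ y ∈ S.powerset.filter (fun y => v ⊆ y), F y = 0)
    (a : α) (ha : ∃ y ⊆ S, F y ≠ 0 ∧ a ∈ y) :
    2 ^ t ≤ ((S.powerset.filter (fun y => F y ≠ 0)).filter (fun y => a ∈ y)).card := by
  obtain ⟨y1, h1S, h1F, h1a⟩ := ha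
  have n1 : ∀ v : Finset α, v.card < t → ∑ y ∈ S.powerset.filter (fun y => v ⊆ y),
      (if a ∈ y then F y else 0) = 0 := by
    intro v hv
    refine Eq.trans ?_ (hF (insert a v) (lt_of_le_of_lt (card_insert_le _ _) (by omega)))
    rw [← sum_filter, filter_filter]
    apply sum_congr _ (fun _ _ => rfl)
    ext z; simp [insert_subset_iff]; tauto
  refine (frankl_pach S t _ n1 ⟨y1, h1S, by simp [h1a, h1F]⟩).trans (card_le_card ?_)
  intro z
  simp only [mem_filter]
  by_cases ha : a ∈ z <;> simp [ha]

/-- Nullity at level `i` gives nullity below. -/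
theorem null_down (S : Finset α) (i : ℕ) (F : Finset α → ℝ)
    (hF : ∀ y, F y ≠ 0 → y.card = i + 1)
    (hN : ∀ v ⊆ S, v.card = i → ∑ b ∈ S \ v, F (insert b v) = 0) :
    ∀ v : Finset α, v.card < i + 1 →
      ∑ y ∈ S.powerset.filter (fun y => v ⊆ y), F y = 0 := by
  have main : ∀ d : ℕ, ∀ v : Finset α, v.card + d = i →
      ∑ y ∈ S.powerset.filter (fun y => v ⊆ y), F y = 0 := by
    intro d
    induction d with
    | zero =>
      intro v hv
      by_cases hvS : v ⊆ S
      swap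
      · apply sum_eq_zero
        intro y hy
        simp only [mem_filter, mem_powerset] at hy
        exact absurd (hy.2.trans hy.1) hvS
      rw [← hN v hvS hv]
      symm
      rw [← sum_filter_ne_zero (s := S.powerset.filter (fun y => v ⊆ y)),
        ← sum_filter_ne_zero (s := S \ v)]
      refine sum_bij (fun b _ => insert b v) ?_ ?_ ?_ (fun _ _ => rfl)
      · intro b hb
        simp only [mem_filter, mem_powerset, mem_sdiff] at hb ⊢
        exact ⟨⟨insert_subset hb.1.1 hvS, subset_insert _ _⟩, hb.2⟩
      · intro b hb b' hb' e
        simp only [mem_filter, mem_sdiff] at hb hb'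
        have : b ∈ insert b' v := e ▸ mem_insert_self b v
        rw [mem_insert] at this
        exact this.resolve_right hb.1.2
      · intro y hy
        simp only [mem_filter, mem_powerset] at hy
        have hc := hF y hy.2
        have : (y \ v).card = 1 := by rw [card_sdiff_of_subset hy.1.2]; omega
        obtain ⟨b, hb⟩ := card_eq_one.mp this
        have hb1 : b ∈ y \ v := by simp [hb]
        rw [mem_sdiff] at hb1
        have hyy : insert b v = y := by
          rw [insert_eq, ← hb, sdiff_union_of_subset hy.1.2]
        refine ⟨b, ?_, hyy⟩
        simp only [mem_filter, mem_sdiff]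
        exact ⟨⟨hy.1.1 hb1.1, hb1.2⟩, by rw [hyy]; exact hy.2⟩
    | succ d ih =>
      intro v hv
      have h1 : ∑ s ∈ S \ v, ∑ y ∈ S.powerset.filter (fun y => insert s v ⊆ y), F y = 0 := by
        apply sum_eq_zero
        intro s hs
        rw [mem_sdiff] at hs
        apply ih
        rw [card_insert_of_notMem hs.2]; omega
      have h2 : ∑ s ∈ S \ v, ∑ y ∈ S.powerset.filter (fun y => insert s v ⊆ y), F y
          = ∑ y ∈ S.powerset.filter (fun y => v ⊆ y), ((i : ℝ) + 1 - v.card) * F y := by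
        have : ∀ s, ∑ y ∈ S.powerset.filter (fun y => insert s v ⊆ y), F y
            = ∑ y ∈ S.powerset.filter (fun y => v ⊆ y), (if s ∈ y then F y else 0) := by
          intro s
          rw [← sum_filter, filter_filter]
          apply sum_congr _ (fun _ _ => rfl)
          ext z; simp [insert_subset_iff]; tauto
        simp only [this]
        rw [sum_comm]
        apply sum_congr rfl
        intro y hy
        simp only [mem_filter, mem_powerset] at hy
        by_cases hFy : F y = 0
        · simp [hFy]
        rw [← sum_filter, sum_const, nsmul_eq_mul]
        congr 1
        have : (S \ v).filter (fun s => s ∈ y) = y \ v := by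
          ext s; simp only [mem_filter, mem_sdiff]
          constructor
          · tauto
          · rintro ⟨h1, h2⟩; exact ⟨⟨hy.1 h1, h2⟩, h1⟩
        rw [this, card_sdiff_of_subset hy.2, Nat.cast_sub (card_le_card hy.2), hF y hFy]
        push_cast; ring
      rw [h1, ← mul_sum] at h2
      have h3 : ((i : ℝ) + 1 - v.card) ≠ 0 := by
        have : (i : ℝ) = v.card + (d + 1) := by rw [← hv]; push_cast; ring
        rw [this]
        have : (0 : ℝ) ≤ d := Nat.cast_nonneg d
        intro h; linarith
      exact (mul_eq_zero.mp h2.symm).resolve_left h3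
  intro v hv
  exact main (i - v.card) v (by omega)

/-- Fibers of `x ↦ x ∩ S`. -/
theorem fiber_card (V S : Finset α) (hS : S ⊆ V) (w : ℕ) (T : Finset α) (hT : T ⊆ S)
    (hTw : T.card ≤ w) :
    ((powersetCard w V).filter (fun x => x ∩ S = T)).card
      = (V.card - S.card).choose (w - T.card) := by
  rw [← card_sdiff_of_subset hS, ← card_powersetCard]
  symm
  refine card_bij (fun E _ => T ∪ E) ?_ ?_ ?_
  · intro E hE
    rw [mem_powersetCard] at hE
    have hdis : Disjoint S E := (disjoint_sdiff).mono_right hE.1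
    simp only [mem_filter, mem_powersetCard]
    refine ⟨⟨union_subset (hT.trans hS) (hE.1.trans sdiff_subset), ?_⟩, ?_⟩
    · rw [card_union_of_disjoint (hdis.mono_left hT), hE.2]; omega
    · rw [union_inter_distrib_right, inter_eq_left.mpr hT, disjoint_iff_inter_eq_empty.mp hdis.symm,
        union_empty]
  · intro E hE E' hE' e
    rw [mem_powersetCard] at hE hE'
    have hdis : Disjoint T E := ((disjoint_sdiff).mono_right hE.1).mono_left hT
    have hdis' : Disjoint T E' := ((disjoint_sdiff).mono_right hE'.1).mono_left hT
    have := congrArg (· \ T) e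
    simpa [union_sdiff_cancel_left hdis, union_sdiff_cancel_left hdis'] using this
  · intro x hx
    simp only [mem_filter, mem_powersetCard] at hx
    refine ⟨x \ S, ?_, ?_⟩
    · rw [mem_powersetCard]
      refine ⟨sdiff_subset_sdiff hx.1.1 le_rfl, ?_⟩
      have := card_sdiff_add_card_inter x S
      rw [hx.2, hx.1.2] at this; omega
    · rw [← hx.2, union_comm, sdiff_union_inter]

theorem big_inter_count (V S : Finset α) (hS : S ⊆ V) (w k : ℕ) (hV : 0 < V.card) :
    ((powersetCard w V).filter (fun x => k ≤ (x ∩ S).card)).card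
      ≤ 2 ^ S.card * V.card ^ (w - k) := by
  have hsub : (powersetCard w V).filter (fun x => k ≤ (x ∩ S).card) ⊆
      (S.powerset.filter (fun T => k ≤ T.card ∧ T.card ≤ w)).biUnion
        (fun T => (powersetCard w V).filter (fun x => x ∩ S = T)) := by
    intro x hx
    simp only [mem_filter, mem_powersetCard, mem_biUnion, mem_powerset] at hx ⊢
    exact ⟨x ∩ S, ⟨inter_subset_right, hx.2, hx.1.2 ▸ card_le_card inter_subset_left⟩, hx.1, rfl⟩
  refine (card_le_card hsub).trans ?_
  refine (card_biUnion_le_card_mul _ _ (V.card ^ (w - k)) ?_).trans ?_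
  · intro T hT
    simp only [mem_filter, mem_powerset] at hT
    rw [fiber_card V S hS w T hT.1 hT.2.2]
    calc _ ≤ (V.card - S.card) ^ (w - T.card) := Nat.choose_le_pow _ _
      _ ≤ V.card ^ (w - T.card) := Nat.pow_le_pow_left (Nat.sub_le _ _) _
      _ ≤ _ := Nat.pow_le_pow_right hV (by omega)
  · apply Nat.mul_le_mul_right
    refine (card_filter_le _ _).trans ?_
    rw [card_powerset]

end JohnsonAux
open Filter in
theorem asym_pow (K c q : ℕ) : ∀ᶠ n : ℕ in atTop, K * n ^ q < (n - c).choose (q + 1) := by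
  filter_upwards [eventually_ge_atTop (2 * (c + q) + K * 2 ^ (q + 1) * (q + 1).factorial + 1)] with n hn
  have h1 := Nat.pow_sub_le_descFactorial (n - c) (q + 1)
  rw [Nat.descFactorial_eq_factorial_mul_choose] at h1
  have h2 : n ≤ 2 * (n - c + 1 - (q + 1)) := by omega
  have h3 : n ^ (q + 1) ≤ 2 ^ (q + 1) * ((q + 1).factorial * (n - c).choose (q + 1)) := by
    calc _ ≤ (2 * (n - c + 1 - (q + 1))) ^ (q + 1) := Nat.pow_le_pow_left h2 _
      _ = 2 ^ (q + 1) * (n - c + 1 - (q + 1)) ^ (q + 1) := by rw [mul_pow]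
      _ ≤ _ := Nat.mul_le_mul_left _ h1
  have hn' : K * 2 ^ (q + 1) * (q + 1).factorial < n := by omega
  have hnp : 0 < n ^ q := Nat.pow_pos (by omega)
  have h4 : (K * 2 ^ (q + 1) * (q + 1).factorial) * n ^ q < n * n ^ q :=
    Nat.mul_lt_mul_of_pos_right hn' hnp
  have h5 : (2 ^ (q + 1) * (q + 1).factorial) * (K * n ^ q)
      < (2 ^ (q + 1) * (q + 1).factorial) * (n - c).choose (q + 1) := by
    calc _ = (K * 2 ^ (q + 1) * (q + 1).factorial) * n ^ q := by ring
      _ < n * n ^ q := h4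
      _ = n ^ (q + 1) := by ring
      _ ≤ _ := h3
      _ = _ := by ring
  exact Nat.lt_of_mul_lt_mul_left h5

theorem choose_sub_aux (n q M : ℕ) : n.choose (q + 1) ≤ (n - M).choose (q + 1) + M * (n ^ q) := by
  induction M with
  | zero => simp
  | succ M ih =>
    refine ih.trans ?_
    have : (n - M).choose (q + 1) ≤ (n - (M + 1)).choose (q + 1) + n ^ q := by
      rcases Nat.eq_zero_or_pos (n - M) with h | h
      · simp [h]
      · obtain ⟨p, hp⟩ : ∃ p, n - M = p + 1 := ⟨n - M - 1, by omega⟩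
        have hp' : n - (M + 1) = p := by omega
        rw [hp, hp', Nat.choose_succ_succ']
        have : p.choose q ≤ n ^ q :=
          (Nat.choose_le_pow _ _).trans (Nat.pow_le_pow_left (by omega) _)
        omega
    nlinarith

open Filter in
theorem asym_ratio (K M q : ℕ) : ∀ᶠ n : ℕ in atTop,
    K * n.choose q ≤ (K + 1) * (n - M).choose q := by
  rcases q with _ | q
  · simp
  filter_upwards [asym_pow (K * M) M q] with n hn
  have := choose_sub_aux n q M
  nlinarith [Nat.mul_le_mul_left K this]

open Filter in
theorem asym_low (K M q r : ℕ) (hqr : q < r) : ∀ᶠ n : ℕ in atTop,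
    K * n.choose q ≤ (n - M).choose r := by
  obtain ⟨p, rfl⟩ : ∃ p, r = p + 1 := ⟨r - 1, by omega⟩
  filter_upwards [asym_pow K M p, eventually_ge_atTop 1] with n hn h1
  have h2 : n.choose q ≤ n ^ p := (Nat.choose_le_pow _ _).trans (Nat.pow_le_pow_right h1 (by omega))
  exact (Nat.mul_le_mul_left K h2).trans hn.le

section JohnsonMain
variable {α : Type*} [DecidableEq α]

theorem sep_bound (V : Finset α) (w : ℕ) (f : Finset α → ℝ) (j k : α) (hj : j ∈ V) (hk : k ∈ V)
    (hjk : j ≠ k) :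
    (jsupp ((V.erase j).erase k) w (fun y => f (insert j y) - f (insert k y))).card ≤
    ((jsupp V (w + 1) f).filter (fun x => (j ∈ x ∧ k ∉ x) ∨ (k ∈ x ∧ j ∉ x))).card := by
  refine le_trans (card_le_card ?_) (card_image_le (f := fun x => (x.erase j).erase k))
  intro y hy
  rw [mem_jsupp] at hy
  obtain ⟨⟨hyV, hyc⟩, hne⟩ := hy
  have hjy : j ∉ y := fun h => by simpa using hyV h
  have hky : k ∉ y := fun h => by simpa using hyV h
  have hyV' : y ⊆ V := hyV.trans ((erase_subset _ _).trans (erase_subset _ _))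
  rw [mem_image]
  by_cases h : f (insert j y) = 0
  · have h2 : f (insert k y) ≠ 0 := by
      intro h2; apply hne; simp [h, h2]
    refine ⟨insert k y, ?_, ?_⟩
    · rw [mem_filter, mem_jsupp]
      refine ⟨⟨⟨insert_subset hk hyV', by rw [card_insert_of_notMem hky, hyc]⟩, h2⟩, Or.inr ?_⟩
      simp [hjk, hjy]
    · rw [erase_right_comm, erase_insert hky, erase_eq_of_notMem hjy]
  · refine ⟨insert j y, ?_, ?_⟩
    · rw [mem_filter, mem_jsupp]
      refine ⟨⟨⟨insert_subset hj hyV', by rw [card_insert_of_notMem hjy, hyc]⟩, h⟩, Or.inl ?_⟩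
      simp [hjk.symm, hky]
    · rw [erase_insert hjy, erase_eq_of_notMem hky]

open Classical in
theorem find_center (V : Finset α) (w : ℕ) (f : Finset α → ℝ) (L : ℕ) (hV : 0 < V.card)
    (hL : ∀ j ∈ V, ∀ k ∈ V, ¬ Itc V w f j k → L ≤
      ((jsupp V (w + 1) f).filter (fun x => (j ∈ x ∧ k ∉ x) ∨ (k ∈ x ∧ j ∉ x))).card)
    (hs : (jsupp V (w + 1) f).card < 2 * L) :
    ∃ j₀ ∈ V, (V.filter (fun k => ¬ Itc V w f j₀ k)).card ≤ 4 * (w + 1) := by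
  by_contra! hcon
  have lower : V.card * (4 * (w + 1) * L) ≤ ∑ j ∈ V, ∑ k ∈ V,
      ((jsupp V (w + 1) f).filter (fun x => (j ∈ x ∧ k ∉ x) ∨ (k ∈ x ∧ j ∉ x))).card := by
    rw [← smul_eq_mul]
    apply card_nsmul_le_sum
    intro j hj
    calc 4 * (w + 1) * L ≤ (V.filter (fun k => ¬ Itc V w f j k)).card * L :=
          Nat.mul_le_mul_right _ (hcon j hj).le
      _ ≤ ∑ k ∈ V.filter (fun k => ¬ Itc V w f j k),
          ((jsupp V (w + 1) f).filter (fun x => (j ∈ x ∧ k ∉ x) ∨ (k ∈ x ∧ j ∉ x))).card := by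
          rw [← smul_eq_mul]
          apply card_nsmul_le_sum
          intro k hk
          rw [mem_filter] at hk
          exact hL j hj k hk.1 hk.2
      _ ≤ _ := sum_le_sum_of_subset (filter_subset _ _)
  have upper : ∑ j ∈ V, ∑ k ∈ V,
      ((jsupp V (w + 1) f).filter (fun x => (j ∈ x ∧ k ∉ x) ∨ (k ∈ x ∧ j ∉ x))).card
      ≤ (jsupp V (w + 1) f).card * (2 * (w + 1) * V.card) := by
    calc _ ≤ ∑ j ∈ V, ∑ k ∈ V, ∑ x ∈ jsupp V (w + 1) f,
          ((if j ∈ x then 1 else 0) + (if k ∈ x then 1 else 0)) := by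
          apply sum_le_sum; intro j _
          apply sum_le_sum; intro k _
          rw [card_filter]
          apply sum_le_sum; intro x _
          by_cases h1 : j ∈ x <;> by_cases h2 : k ∈ x <;> simp [h1, h2]
      _ = ∑ x ∈ jsupp V (w + 1) f, ∑ j ∈ V, ∑ k ∈ V,
          ((if j ∈ x then 1 else 0) + (if k ∈ x then 1 else 0)) := by
          rw [sum_comm (s := jsupp V (w + 1) f)]
          apply sum_congr rfl
          intro j _
          exact sum_comm
      _ = ∑ x ∈ jsupp V (w + 1) f, 2 * (w + 1) * V.card := by
          apply sum_congr rfl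
          intro x hx
          rw [mem_jsupp] at hx
          simp only [sum_add_distrib, sum_const, sum_ite_mem, smul_eq_mul]
          rw [← mul_sum, sum_ite_mem, inter_eq_right.mpr hx.1.1]
          simp [hx.1.2]; ring
      _ = _ := by simp
  have h1 : (jsupp V (w + 1) f).card * (2 * (w + 1) * V.card) < 2 * L * (2 * (w + 1) * V.card) :=
    Nat.mul_lt_mul_of_pos_right hs (by positivity)
  nlinarith

theorem struct_case (V : Finset α) (i w M : ℕ) (hiw : i ≤ w) (lam : ℝ) (f : Finset α → ℝ)
    (hE : Eig V (w + 1) lam f) (x₀ : Finset α) (hx₀ : x₀ ⊆ V) (hx₀c : x₀.card = w + 1)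
    (hfx₀ : f x₀ ≠ 0)
    (hIH : ∀ j ∈ V, ∀ k ∈ V, ¬ Itc V w f j k → 2 ^ i * (V.card - 2 - 2 * i).choose (w - i) ≤
      (jsupp ((V.erase j).erase k) w (fun y => f (insert j y) - f (insert k y))).card)
    (hn : M + w + 2 ≤ V.card)
    (A1 : ∀ s ≤ i, 2 ^ (i + 1) * V.card.choose (w - i) ≤ (V.card - M).choose (w + 1 - s))
    (A2 : 2 ^ (i + 1) * V.card.choose (w - i) ≤ (2 ^ (i + 1) + 1) * (V.card - M).choose (w - i))
    (A3 : i < w → 2 ^ M * V.card ^ (w - i - 1) < (V.card - 2 - 2 * i).choose (w - i))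
    (A4 : w - i ≤ V.card - 2 - 2 * i)
    (j₀ : α) (hj₀ : j₀ ∈ V) (S : Finset α) (hS : ∀ k, k ∈ S ↔ k ∈ V ∧ ¬ Itc V w f j₀ k)
    (hSM : S.card ≤ M) :
    2 ^ (i + 1) * (V.card - 2 * (i + 1)).choose (w - i) ≤ (jsupp V (w + 1) f).card := by
  have hSV : S ⊆ V := fun k hk => ((hS k).1 hk).1
  have hj₀S : j₀ ∉ S := fun h => ((hS j₀).1 h).2 (fun _ _ _ _ _ => rfl)
  have hB : ∀ a ∈ V, a ∉ S → Itc V w f j₀ a := by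
    intro a ha haS
    by_contra h
    exact haS ((hS a).2 ⟨ha, h⟩)
  -- invariance
  have inv : ∀ x ⊆ V, x.card = w + 1 → ∀ x' ⊆ V, x'.card = w + 1 → x ∩ S = x' ∩ S →
      f x' = f x := by
    intro x hx hxc x' hx' hxc' hxx
    refine (exch_conn V (w + 1) (fun z => f z = f x ∧ z ∩ S = x' ∩ S) x' hx' hxc' ?_
      _ x hx hxc ⟨rfl, hxx⟩ rfl).1
    rintro z hz hzc ⟨hzf, hzS⟩ a ha hax b hb hbz
    have haS : a ∉ S := by
      intro h
      have : a ∈ x' ∩ S := hzS ▸ mem_inter.mpr ⟨ha, h⟩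
      exact hax (mem_inter.mp this).1
    have hbS : b ∉ S := by
      intro h
      have : b ∈ z ∩ S := hzS ▸ mem_inter.mpr ⟨hb, h⟩
      exact hbz (mem_inter.mp this).1
    have hI : Itc V w f a b :=
      Itc.trans (hz ha) (hx' hb) (hB a (hz ha) haS).symm (hB b (hx' hb) hbS)
    have := hI (z.erase a) ((erase_subset _ _).trans hz)
      (by rw [card_erase_of_mem ha, hzc]; rfl) (by simp)
      (fun h => hbz (mem_of_mem_erase h))
    rw [insert_erase ha] at this
    refine ⟨by rw [← this, hzf], ?_⟩
    rw [← hzS]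
    ext c
    simp only [mem_inter, mem_insert, mem_erase]
    constructor
    · rintro ⟨rfl | h, h2⟩
      · exact absurd h2 hbS
      · exact ⟨h.2, h2⟩
    · rintro ⟨h1, h2⟩
      exact ⟨Or.inr ⟨fun e => haS (e ▸ h2), h1⟩, h2⟩
  have hchmono : ∀ q, (V.card - M).choose q ≤ (V.card - S.card).choose q :=
    fun q => Nat.choose_le_choose q (by omega)
  by_cases hlow : ∃ x ⊆ V, x.card = w + 1 ∧ (x ∩ S).card ≤ i ∧ f x ≠ 0
  · -- dense case
    obtain ⟨x, hx, hxc, hxi, hfx⟩ := hlow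
    calc _ ≤ 2 ^ (i + 1) * V.card.choose (w - i) :=
          Nat.mul_le_mul_left _ (Nat.choose_le_choose _ (Nat.sub_le _ _))
      _ ≤ _ := A1 _ hxi
      _ ≤ _ := hchmono _
      _ = _ := (fiber_card V S hSV (w + 1) (x ∩ S) inter_subset_right (by omega)).symm
      _ ≤ _ := by
        apply card_le_card
        intro z hz
        simp only [mem_filter, mem_powersetCard] at hz
        rw [mem_jsupp]
        exact ⟨hz.1, by rw [inv x hx hxc z hz.1.1 hz.1.2 hz.2.symm]; exact hfx⟩
  push Not at hlow
  -- choose a filling set outside `S`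
  have hcardB : w + 2 ≤ (V \ S).card := by rw [card_sdiff_of_subset hSV]; omega
  obtain ⟨E', hE'sub, hE'c⟩ := exists_subset_card_eq (show w - i + 1 ≤ (V \ S).card by omega)
  obtain ⟨e, he⟩ := card_pos.mp (show 0 < E'.card by omega)
  set E := E'.erase e with hEdef
  have hEc : E.card = w - i := by rw [hEdef, card_erase_of_mem he, hE'c]; rfl
  have hEsub : E ⊆ V \ S := (erase_subset _ _).trans hE'sub
  have hdisE : Disjoint S E := disjoint_sdiff.mono_right hEsub
  have hdisE' : Disjoint S E' := disjoint_sdiff.mono_right hE'sub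
  have unionS : ∀ (T D : Finset α), T ⊆ S → Disjoint S D → (T ∪ D) ∩ S = T := by
    intro T D hT hD
    rw [union_inter_distrib_right, inter_eq_left.mpr hT, disjoint_iff_inter_eq_empty.mp hD.symm,
      union_empty]
  set F : Finset α → ℝ := fun T => if T.card = i + 1 then f (T ∪ E) else 0 with hFdef
  have hFval : ∀ x ⊆ V, x.card = w + 1 → (x ∩ S).card = i + 1 → f x = F (x ∩ S) := by
    intro x hx hxc hxi
    simp only [hFdef, hxi, if_true]
    refine inv _ ?_ ?_ x hx hxc ?_
    · exact union_subset (inter_subset_left.trans hx) (hEsub.trans sdiff_subset)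
    · rw [card_union_of_disjoint (hdisE.mono_left inter_subset_right), hxi, hEc]; omega
    · exact unionS _ _ inter_subset_right hdisE
  have hFcard : ∀ y, F y ≠ 0 → y.card = i + 1 := by
    intro y hy
    by_contra h
    exact hy (by simp [hFdef, h])
  -- harmonicity
  have hN : ∀ v ⊆ S, v.card = i → ∑ b ∈ S \ v, F (insert b v) = 0 := by
    intro v hv hvc
    have hvE' : Disjoint v E' := hdisE'.mono_left hv
    have hxV : v ∪ E' ⊆ V := union_subset (hv.trans hSV) (hE'sub.trans sdiff_subset)
    have hxc : (v ∪ E').card = w + 1 := by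
      rw [card_union_of_disjoint hvE', hvc, hE'c]; omega
    have h0 : f (v ∪ E') = 0 := hlow _ hxV hxc (by rw [unionS v E' hv hdisE', hvc])
    have heq := hE _ hxV hxc
    rw [h0, mul_zero, sum_union hvE'] at heq
    have hcardx : ∀ a ∈ v ∪ E', ∀ b ∈ V \ (v ∪ E'),
        insert b ((v ∪ E').erase a) ⊆ V ∧ (insert b ((v ∪ E').erase a)).card = w + 1 := by
      intro a ha b hb
      rw [mem_sdiff] at hb
      refine ⟨insert_subset hb.1 ((erase_subset _ _).trans hxV), ?_⟩
      rw [card_insert_of_notMem (fun h => hb.2 (mem_of_mem_erase h)), card_erase_of_mem ha, hxc]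
      rfl
    have hz1 : ∑ a ∈ v, ∑ b ∈ V \ (v ∪ E'), f (insert b ((v ∪ E').erase a)) = 0 := by
      apply sum_eq_zero; intro a ha
      apply sum_eq_zero; intro b hb
      obtain ⟨c1, c2⟩ := hcardx a (mem_union_left _ ha) b hb
      apply hlow _ c1 c2
      have : insert b ((v ∪ E').erase a) ∩ S ⊆ insert b (v.erase a) := by
        intro c hc
        simp only [mem_inter, mem_insert, mem_erase, mem_union] at hc ⊢
        rcases hc with ⟨h | ⟨h1, h2 | h2⟩, h3⟩
        · exact Or.inl h
        · exact Or.inr ⟨h1, h2⟩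
        · exact absurd h2 (disjoint_left.mp hdisE' h3)
      refine (card_le_card this).trans ((card_insert_le _ _).trans ?_)
      rw [card_erase_of_mem ha]
      have := card_pos.mpr ⟨a, ha⟩
      omega
    have hz2 : ∀ a ∈ E', ∑ b ∈ V \ (v ∪ E'), f (insert b ((v ∪ E').erase a))
        = ∑ b ∈ S \ v, F (insert b v) := by
      intro a ha
      have haS : a ∉ S := fun h => disjoint_left.mp hdisE' h ha
      have hsub : S \ v ⊆ V \ (v ∪ E') := by
        intro b hb
        simp only [mem_sdiff, mem_union] at hb ⊢
        refine ⟨hSV hb.1, ?_⟩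
        rintro (h | h)
        · exact hb.2 h
        · exact disjoint_left.mp hdisE' hb.1 h
      rw [← sum_subset hsub]
      · apply sum_congr rfl
        intro b hb
        obtain ⟨c1, c2⟩ := hcardx a (mem_union_right _ ha) b (hsub hb)
        rw [mem_sdiff] at hb
        have hint : insert b ((v ∪ E').erase a) ∩ S = insert b v := by
          ext c
          simp only [mem_inter, mem_insert, mem_erase, mem_union]
          constructor
          · rintro ⟨h | ⟨h1, h2 | h2⟩, h3⟩
            · exact Or.inl h
            · exact Or.inr h2
            · exact absurd h2 (disjoint_left.mp hdisE' h3)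
          · rintro (h | h)
            · exact ⟨Or.inl h, h ▸ hb.1⟩
            · exact ⟨Or.inr ⟨fun e => haS (e ▸ hv h), Or.inl h⟩, hv h⟩
        rw [hFval _ c1 c2 (by rw [hint, card_insert_of_notMem hb.2, hvc]), hint]
      · intro b hb hbS
        obtain ⟨c1, c2⟩ := hcardx a (mem_union_right _ ha) b hb
        apply hlow _ c1 c2
        have : insert b ((v ∪ E').erase a) ∩ S ⊆ v := by
          intro c hc
          simp only [mem_inter, mem_insert, mem_erase, mem_union] at hc
          rcases hc with ⟨h | ⟨h1, h2 | h2⟩, h3⟩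
          · subst h
            simp only [mem_sdiff, mem_union] at hb hbS
            tauto
          · exact h2
          · exact absurd h2 (disjoint_left.mp hdisE' h3)
        exact (card_le_card this).trans hvc.le
    rw [hz1, zero_add, sum_congr rfl hz2, sum_const, hE'c, nsmul_eq_mul] at heq
    refine (mul_eq_zero.mp heq).resolve_left ?_
    positivity
  have hnull := null_down S i F hFcard hN
  -- every point of `S` is covered
  have hcov : ∀ j ∈ S, ∃ y ⊆ S, F y ≠ 0 ∧ j ∈ y := by
    intro j hj
    by_contra! hcon
    have hL := hIH j (hSV hj) j₀ hj₀ (fun h => ((hS j).1 hj).2 h.symm)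
    have hsub : jsupp ((V.erase j).erase j₀) w (fun y => f (insert j y) - f (insert j₀ y)) ⊆
        (powersetCard w V).filter (fun x => i + 1 ≤ (x ∩ S).card) := by
      intro y hy
      rw [mem_jsupp] at hy
      obtain ⟨⟨hyV, hyc⟩, hne⟩ := hy
      have hjy : j ∉ y := fun h => by simpa using hyV h
      have hky : j₀ ∉ y := fun h => by simpa using hyV h
      have hyV' : y ⊆ V := hyV.trans ((erase_subset _ _).trans (erase_subset _ _))
      rw [mem_filter, mem_powersetCard]
      refine ⟨⟨hyV', hyc⟩, ?_⟩
      by_contra! hlt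
      apply hne
      have e1 : f (insert j₀ y) = 0 := by
        apply hlow _ (insert_subset hj₀ hyV') (by rw [card_insert_of_notMem hky, hyc])
        rw [insert_inter_of_notMem hj₀S]; omega
      have e2 : f (insert j y) = 0 := by
        have c1 := insert_subset (hSV hj) hyV'
        have c2 : (insert j y).card = w + 1 := by rw [card_insert_of_notMem hjy, hyc]
        have c3 : (insert j y ∩ S).card = (y ∩ S).card + 1 := by
          rw [insert_inter_of_mem hj, card_insert_of_notMem (by simp [hjy])]
        by_cases hc : (y ∩ S).card = i
        · rw [hFval _ c1 c2 (by omega)]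
          by_contra hF0
          exact hcon _ inter_subset_right hF0 (by simp [hj])
        · exact hlow _ c1 c2 (by omega)
      simp [e1, e2]
    have hle := hL.trans (card_le_card hsub)
    have hpos : 0 < (V.card - 2 - 2 * i).choose (w - i) := Nat.choose_pos A4
    have h2 : (V.card - 2 - 2 * i).choose (w - i) ≤
        2 ^ i * (V.card - 2 - 2 * i).choose (w - i) := Nat.le_mul_of_pos_left _ (by positivity)
    rcases Nat.lt_or_ge i w with hlt | hge
    · have h3 := big_inter_count V S hSV w (i + 1) (by omega)
      have h4 : 2 ^ S.card * V.card ^ (w - (i + 1)) ≤ 2 ^ M * V.card ^ (w - i - 1) := by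
        rw [Nat.sub_sub]
        exact Nat.mul_le_mul_right _ (Nat.pow_le_pow_right (by norm_num) hSM)
      have := A3 hlt
      omega
    · have : (powersetCard w V).filter (fun x => i + 1 ≤ (x ∩ S).card) = ∅ := by
        rw [filter_eq_empty_iff]
        intro x hx
        rw [mem_powersetCard] at hx
        have := card_le_card (inter_subset_left : x ∩ S ⊆ x)
        omega
      rw [this, card_empty] at hle
      omega
  -- nonzero
  have hnz : ∃ y ⊆ S, F y ≠ 0 := by
    have : i < (x₀ ∩ S).card := by
      by_contra! h
      exact hfx₀ (hlow x₀ hx₀ hx₀c h)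
    obtain ⟨j, hj⟩ := card_pos.mp (show 0 < (x₀ ∩ S).card by omega)
    obtain ⟨y, h1, h2, -⟩ := hcov j (mem_inter.mp hj).2
    exact ⟨y, h1, h2⟩
  set Y := S.powerset.filter (fun y => F y ≠ 0) with hY
  have hYc : 2 ^ (i + 1) ≤ Y.card := frankl_pach S (i + 1) F hnull hnz
  -- degree count
  have hdeg : S.card * 2 ^ i ≤ Y.card * (i + 1) := by
    calc S.card * 2 ^ i ≤ ∑ a ∈ S, (Y.filter (fun y => a ∈ y)).card := by
          rw [← smul_eq_mul]
          apply card_nsmul_le_sum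
          intro a ha
          exact frankl_pach_deg S i F hnull a (hcov a ha)
      _ = ∑ y ∈ Y, (S.filter (fun a => a ∈ y)).card := by
          simp only [card_filter]
          exact sum_comm
      _ = ∑ y ∈ Y, (i + 1) := by
          apply sum_congr rfl
          intro y hy
          rw [hY, mem_filter, mem_powerset] at hy
          rw [filter_mem_eq_inter, inter_eq_right.mpr hy.1, hFcard y hy.2]
      _ = _ := by simp
  -- counting the support
  have hcount : Y.card * (V.card - S.card).choose (w - i) ≤ (jsupp V (w + 1) f).card := by
    have hsub : Y.biUnion (fun T => (powersetCard (w + 1) V).filter (fun x => x ∩ S = T)) ⊆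
        jsupp V (w + 1) f := by
      intro x hx
      rw [mem_biUnion] at hx
      obtain ⟨T, hT, hx⟩ := hx
      rw [hY, mem_filter] at hT
      rw [mem_filter, mem_powersetCard] at hx
      rw [mem_jsupp]
      refine ⟨hx.1, ?_⟩
      rw [hFval x hx.1.1 hx.1.2 (by rw [hx.2]; exact hFcard T hT.2), hx.2]
      exact hT.2
    refine le_trans (le_of_eq ?_) (card_le_card hsub)
    rw [card_biUnion]
    · rw [sum_congr rfl (g := fun _ => (V.card - S.card).choose (w - i)), sum_const, smul_eq_mul]
      intro T hT
      rw [hY, mem_filter, mem_powerset] at hT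
      have hc := hFcard T hT.2
      rw [fiber_card V S hSV (w + 1) T hT.1 (by omega), hc]
      congr 1; omega
    · intro T _ T' _ hne
      refine disjoint_filter.mpr ?_
      intro x _ h1 h2
      exact hne (h1.symm.trans h2)
  refine le_trans ?_ hcount
  rcases hYc.eq_or_lt with h | h
  · rw [← h]
    apply Nat.mul_le_mul_left
    apply Nat.choose_le_choose
    rw [← h, pow_succ] at hdeg
    have : S.card ≤ 2 * (i + 1) := by
      have hp : 0 < 2 ^ i := by positivity
      nlinarith
    omega
  · calc _ ≤ 2 ^ (i + 1) * V.card.choose (w - i) :=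
          Nat.mul_le_mul_left _ (Nat.choose_le_choose _ (Nat.sub_le _ _))
      _ ≤ _ := A2
      _ ≤ _ := Nat.mul_le_mul h (hchmono _)

open Filter in
theorem general_bound (i : ℕ) : ∀ w : ℕ, i ≤ w → ∃ n₀ : ℕ, ∀ (β : Type) [DecidableEq β]
    (V : Finset β), n₀ ≤ V.card → ∀ f : Finset β → ℝ, (∃ x ⊆ V, x.card = w ∧ f x ≠ 0) →
    Eig V w (((w : ℝ) - i) * ((V.card : ℝ) - w - i) - i) f →
    2 ^ i * (V.card - 2 * i).choose (w - i) ≤ (jsupp V w f).card := by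
  induction i with
  | zero =>
    intro w _
    refine ⟨w, fun β _ V hV f ⟨x, hx, hc, hf⟩ hE => ?_⟩
    have := base_case V w hV f (by simpa using hE) x hx hc hf
    simpa using this
  | succ i ih =>
    intro w' hw'
    obtain ⟨w, rfl⟩ : ∃ w, w' = w + 1 := ⟨w' - 1, by omega⟩
    have hiw : i ≤ w := by omega
    obtain ⟨n₁, hn₁⟩ := ih w hiw
    have ev1 : ∀ᶠ n : ℕ in atTop, ∀ s ∈ Finset.range (i + 1),
        2 ^ (i + 1) * n.choose (w - i) ≤ (n - 4 * (w + 1)).choose (w + 1 - s) := by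
      rw [Filter.eventually_all_finset]
      intro s hs
      rw [Finset.mem_range] at hs
      exact asym_low _ _ _ _ (by omega)
    have ev2 := asym_ratio (2 ^ (i + 1)) (4 * (w + 1)) (w - i)
    have ev3 := asym_pow (2 ^ (4 * (w + 1))) (2 + 2 * i) (w - i - 1)
    obtain ⟨n₀, hn₀⟩ := eventually_atTop.mp (ev1.and (ev2.and ev3))
    refine ⟨max n₀ (n₁ + 4 * (w + 1) + w + 2 * i + 10), fun β _ V hV f ⟨x, hx, hc, hf⟩ hE => ?_⟩
    obtain ⟨A1, A2, A3⟩ := hn₀ V.card (le_trans (le_max_left _ _) hV)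
    have hV2 := le_trans (le_max_right _ _) hV
    have hww : w + 1 - (i + 1) = w - i := by omega
    rw [hww]
    have hIH : ∀ j ∈ V, ∀ k ∈ V, ¬ Itc V w f j k →
        2 ^ i * (V.card - 2 - 2 * i).choose (w - i) ≤
        (jsupp ((V.erase j).erase k) w (fun y => f (insert j y) - f (insert k y))).card := by
      intro j hj k hk hn
      have hjk : j ≠ k := by
        rintro rfl
        exact hn (fun _ _ _ _ _ => rfl)
      have hcard : ((V.erase j).erase k).card = V.card - 2 := by
        rw [card_erase_of_mem (mem_erase.mpr ⟨hjk.symm, hk⟩), card_erase_of_mem hj]; rfl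
      have := hn₁ β ((V.erase j).erase k) (by omega) (fun y => f (insert j y) - f (insert k y)) ?_ ?_
      · rwa [hcard] at this
      · unfold Itc at hn
        push Not at hn
        obtain ⟨y, hy, hyc, hjy, hky, hne⟩ := hn
        refine ⟨y, ?_, hyc, sub_ne_zero.mpr hne⟩
        intro a ha
        simp only [mem_erase]
        exact ⟨fun e => hky (e ▸ ha), fun e => hjy (e ▸ ha), hy ha⟩
      · have h := eig_diff hk hj hjk hE
        rw [hcard, Nat.cast_sub (by omega)]
        convert h using 1
        push_cast
        ring
    by_contra! hlt
    classical
    obtain ⟨j₀, hj₀, hc₀⟩ := find_center V w f (2 ^ i * (V.card - 2 - 2 * i).choose (w - i))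
      (by omega)
      (fun j hj k hk hn => (hIH j hj k hk hn).trans (sep_bound V w f j k hj hk (by
        rintro rfl
        exact hn (fun _ _ _ _ _ => rfl))))
      (by
        have e : V.card - 2 * (i + 1) = V.card - 2 - 2 * i := by omega
        rw [e, pow_succ] at hlt
        linarith)
    refine absurd (struct_case V i w (4 * (w + 1)) hiw _ f hE x hx hc hf hIH (by omega)
      (fun s hs => A1 s (Finset.mem_range.mpr (by omega))) A2 ?_ (by omega) j₀ hj₀
      (V.filter (fun k => ¬ Itc V w f j₀ k)) (fun k => by simp) ?_) (not_le.mpr hlt)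
    · intro hlt
      have e : w - i - 1 + 1 = w - i := by omega
      rw [e] at A3
      rwa [Nat.sub_sub V.card]
    · convert hc₀

end JohnsonMain

/-- For all positive integers `i ≤ w` there is `n₀(i,w)` such that for all
`n ≥ n₀(i,w)`, every nonzero eigenfunction of `J(n,w)` with eigenvalue
`(w-i)(n-w-i) - i` has support of size at least `2^i * C(n-2i, w-i)`. -/
theorem main_support_bound (i w : ℕ) (hi : 1 ≤ i) (hiw : i ≤ w) :
    ∃ n₀ : ℕ, ∀ n : ℕ, n₀ ≤ n →
      ∀ f : Finset (Fin n) → ℝ,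
        (∃ x : Finset (Fin n), x.card = w ∧ f x ≠ 0) →
        (∀ x : Finset (Fin n), x.card = w →
          ∑ y ∈ univ.filter (fun y : Finset (Fin n) => y.card = w ∧ (x ∩ y).card + 1 = w), f y
            = (((w : ℝ) - i) * ((n : ℝ) - w - i) - i) * f x) →
        2 ^ i * Nat.choose (n - 2 * i) (w - i)
          ≤ (univ.filter (fun x : Finset (Fin n) => x.card = w ∧ f x ≠ 0)).card := by
  obtain ⟨n₀, hn₀⟩ := general_bound i w hiw
  refine ⟨n₀, fun n hn f ⟨x, hxc, hfx⟩ hE => ?_⟩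
  have h := hn₀ (Fin n) univ (by simpa using hn) f ⟨x, subset_univ _, hxc, hfx⟩ ?_
  · have e : jsupp univ w f = univ.filter (fun x : Finset (Fin n) => x.card = w ∧ f x ≠ 0) := by
      ext z; simp [mem_jsupp]
    rw [e] at h
    simpa using h
  · intro z _ hzc
    have h2 := hE z hzc
    rw [card_univ, Fintype.card_fin, ← h2, ← sum_product']
    refine sum_bij (fun p _ => insert p.2 (z.erase p.1)) ?_ ?_ ?_ (fun _ _ => rfl)
    · rintro ⟨a, b⟩ hp
      simp only [mem_product, mem_sdiff, mem_univ, true_and] at hp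
      obtain ⟨ha, hb⟩ := hp
      have hpos := card_pos.mpr ⟨a, ha⟩
      have e1 : z ∩ insert b (z.erase a) = z.erase a := by
        rw [inter_insert_of_notMem hb, inter_eq_right.mpr (erase_subset _ _)]
      simp only [mem_filter, mem_univ, true_and]
      rw [e1, card_insert_of_notMem (fun h => hb (mem_of_mem_erase h)), card_erase_of_mem ha]
      omega
    · rintro ⟨a, b⟩ hp ⟨a', b'⟩ hp' he
      simp only [mem_product, mem_sdiff, mem_univ, true_and] at hp hp' he
      have hb : b ∈ insert b' (z.erase a') := he ▸ mem_insert_self _ _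
      have hb2 : b = b' := by
        rw [mem_insert, mem_erase] at hb
        tauto
      have ha : a ∉ insert b' (z.erase a') := by
        rw [← he, mem_insert, mem_erase]
        rintro (h | h)
        · exact hp.2 (h ▸ hp.1)
        · exact h.1 rfl
      have ha2 : a = a' := by
        rw [mem_insert, mem_erase] at ha
        tauto
      rw [ha2, hb2]
    · intro y hy
      simp only [mem_filter, mem_univ, true_and] at hy
      have c1 := card_sdiff_add_card_inter z y
      have c2 := card_sdiff_add_card_inter y z
      rw [inter_comm] at c2
      obtain ⟨a, ha⟩ := card_eq_one.mp (show (z \ y).card = 1 by omega)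
      obtain ⟨b, hb⟩ := card_eq_one.mp (show (y \ z).card = 1 by omega)
      have ha1 : a ∈ z \ y := by simp [ha]
      have hb1 : b ∈ y \ z := by simp [hb]
      rw [mem_sdiff] at ha1 hb1
      refine ⟨(a, b), ?_, ?_⟩
      · simp [ha1.1, hb1.2]
      · have e1 : z.erase a = y ∩ z := by
          rw [erase_eq, ← ha, sdiff_sdiff_right_self, inf_eq_inter, inter_comm]
        change insert b (z.erase a) = y
        rw [e1, insert_eq, ← hb, sdiff_union_inter]
end
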